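/- arXiv:2204.03223 — 2 statements merged into one kernel-verified Lean document; each statement's English description precedes it below -/
import Mathlib

section
/- Fix natural numbers m, N, T, Q with T ≤ N ≤ m, T ≤ Q, and N − T ≤ m − Q. Define the success probability P₀(Q,T) = C(m−Q, N−T) / C(m−T, N−T) (real-valued quotient of binomial coefficients) and the error probability P_e(Q,T) = 1 − P₀(Q,T). Then P_e(Q,T) is bounded below as: 1 − (1 − (N−T)/(m+1))^Q · C(m, N−T)/C(m−T, N−T) ≤ P_e(Q,T). -/
lemma step_aux (m k n : ℕ) (hn : n ≤ m) :
    ((n - 1).choose k : ℝ) ≤ (1 - (k : ℝ) / ((m : ℝ) + 1)) * (n.choose k : ℝ) := by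
  rcases n with _ | n
  · rcases k with _ | k <;> simp
  · simp only [Nat.add_sub_cancel]
    rcases Nat.lt_or_ge (n + 1) k with h | h
    · rw [Nat.choose_eq_zero_of_lt h, Nat.choose_eq_zero_of_lt (by omega)]; simp
    · have h1 := Nat.choose_mul_succ_eq n k
      have h2 : (n.choose k : ℝ) * ((n : ℝ) + 1) = ((n + 1).choose k : ℝ) * ((n : ℝ) + 1 - k) := by
        have := congrArg (Nat.cast (R := ℝ)) h1
        rw [Nat.cast_mul, Nat.cast_mul, Nat.cast_sub h] at this
        push_cast at this
        exact this
      have hp : (0 : ℝ) < (n : ℝ) + 1 := by positivity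
      have h3 : (n.choose k : ℝ) = (1 - (k : ℝ) / ((n : ℝ) + 1)) * ((n + 1).choose k : ℝ) := by
        field_simp
        linarith
      rw [h3]
      have hm : (n : ℝ) ≤ m := by exact_mod_cast (by omega : n ≤ m)
      gcongr

lemma pow_aux (m k : ℕ) (hk : k ≤ m) (q : ℕ) :
    ((m - q).choose k : ℝ) ≤ (1 - (k : ℝ) / ((m : ℝ) + 1)) ^ q * (m.choose k : ℝ) := by
  have hr : 0 ≤ 1 - (k : ℝ) / ((m : ℝ) + 1) := by
    have : (k : ℝ) ≤ m := by exact_mod_cast hk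
    rw [sub_nonneg, div_le_one (by positivity)]
    linarith
  induction q with
  | zero => simp
  | succ q ih =>
    have h := step_aux m k (m - q) (Nat.sub_le _ _)
    rw [Nat.sub_sub] at h
    refine h.trans ?_
    rw [pow_succ', mul_assoc]
    exact mul_le_mul_of_nonneg_left ih hr

/-- Lower bound on the error probability `P_e(Q,T) = 1 - C(m-Q, N-T)/C(m-T, N-T)`
in the semantic-functional communication model. -/
theorem error_probability_lower_bound (m N T Q : ℕ)
    (hTN : T ≤ N) (hNm : N ≤ m) (hTQ : T ≤ Q) (hQ : N - T ≤ m - Q) :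
    1 - (1 - ((N - T : ℕ) : ℝ) / ((m : ℝ) + 1)) ^ Q *
        ((m.choose (N - T) : ℝ) / ((m - T).choose (N - T) : ℝ))
      ≤ 1 - ((m - Q).choose (N - T) : ℝ) / ((m - T).choose (N - T) : ℝ) := by
  have h := pow_aux m (N - T) (by omega) Q
  rw [← mul_div_assoc]
  exact sub_le_sub_left (div_le_div_of_nonneg_right h (Nat.cast_nonneg _)) 1
end

section
/- Fix natural numbers m, N, T, Q with T ≤ N ≤ m, T ≤ Q, and N − T ≤ m − Q. Define the success probability P₀(Q,T) = C(m−Q, N−T) / C(m−T, N−T) (real-valued quotient of binomial coefficients) and the error probability P_e(Q,T) = 1 − P₀(Q,T). Then P_e(Q,T) is bounded above as: P_e(Q,T) ≤ 1 − (1 − (N−T)/(m−Q+1))^Q · C(m, N−T)/C(m−T, N−T). -/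
theorem aux_bound (a n : ℕ) (h : n ≤ a) (Q : ℕ) :
    (1 - (n : ℝ) / ((a : ℝ) + 1)) ^ Q * ((a + Q).choose n : ℝ) ≤ (a.choose n : ℝ) := by
  have ha : (0 : ℝ) < (a : ℝ) + 1 := by positivity
  have hn : (n : ℝ) ≤ a := by exact_mod_cast h
  have hr : 0 ≤ 1 - (n : ℝ) / ((a : ℝ) + 1) := by
    rw [sub_nonneg, div_le_one ha]; linarith
  induction Q with
  | zero => simp
  | succ q ih =>
    refine le_trans ?_ ih
    rw [pow_succ, mul_assoc]
    refine mul_le_mul_of_nonneg_left ?_ (pow_nonneg hr q)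
    have key := Nat.choose_mul_succ_eq (a + q) n
    have key2 : ((a + q).choose n : ℝ) * ((a : ℝ) + q + 1)
        = ((a + q + 1).choose n : ℝ) * ((a : ℝ) + q + 1 - n) := by
      have h2 : ((a + q + 1 - n : ℕ) : ℝ) = (a : ℝ) + q + 1 - n := by
        rw [Nat.cast_sub (by omega)]; push_cast; ring
      rw [← h2]; exact_mod_cast key
    have hp : (0 : ℝ) < (a : ℝ) + q + 1 := by positivity
    have e : ((a + q).choose n : ℝ)
        = (1 - (n : ℝ) / ((a : ℝ) + q + 1)) * ((a + q + 1).choose n : ℝ) := by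
      field_simp
      linarith
    rw [e, ← add_assoc]
    refine mul_le_mul_of_nonneg_right ?_ (Nat.cast_nonneg _)
    refine sub_le_sub_left ?_ 1
    refine div_le_div_of_nonneg_left (Nat.cast_nonneg _) ha ?_
    have : (0 : ℝ) ≤ q := Nat.cast_nonneg _
    linarith


/-- Upper bound on the error probability `P_e(Q,T) = 1 - C(m-Q, N-T)/C(m-T, N-T)`
in the semantic-functional communication model. -/
theorem error_probability_upper_bound (m N T Q : ℕ)
    (hTN : T ≤ N) (hNm : N ≤ m) (hTQ : T ≤ Q) (hQ : N - T ≤ m - Q) :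
    1 - ((m - Q).choose (N - T) : ℝ) / ((m - T).choose (N - T) : ℝ)
      ≤ 1 - (1 - ((N - T : ℕ) : ℝ) / ((m : ℝ) - (Q : ℝ) + 1)) ^ Q *
          ((m.choose (N - T) : ℝ) / ((m - T).choose (N - T) : ℝ)) := by
  refine sub_le_sub_left ?_ 1
  rw [← mul_div_assoc]
  refine div_le_div_of_nonneg_right ?_ (Nat.cast_nonneg _)
  by_cases hm : Q ≤ m
  · have := aux_bound (m - Q) (N - T) hQ Q
    rwa [Nat.sub_add_cancel hm, Nat.cast_sub hm] at this
  · have h0 : N - T = 0 := by omega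
    simp [h0]
end
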